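/- Let F be a discrete isothermic net with cross ratio factorizing function a and let F̂¹, F̂² : M → L⁴ be Darboux transforms of F with distinct nonzero parameters μ₁ ≠ μ₂. Assume that at every vertex i and on every edge (ij) the vectors F̂¹_i and F̂²_i are linearly independent modulo span{F_i, F_j} (equivalently, the edge circles span{F_i,F_j,F̂¹_i} and span{F_i,F_j,F̂²_i} do not coincide). Suppose there exists Q ∈ ℝ^5∖{0} with ⟨Q,Q⟩ ≠ 0 such that Q ∈ span{F̂¹_i, F̂²_i} at every vertex i (as holds when F̂¹ and F̂² are antipodal nets in the non-Euclidean space form determined by Q). Then F admits a normalized linear conserved quantity: there exist Z : M → ℝ^5 with ⟨Z_i,Z_i⟩ = 1 at every vertex and a constant Q' ∈ ℝ^5 such that λ ↦ λ·Z_i + Q' is a polynomial conserved quantity of F of degree 1. -/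

import Mathlib

noncomputable section

/-- The Minkowski bilinear form of signature (4,1) on `ℝ^5`. -/
def mink (x y : Fin 5 → ℝ) : ℝ :=
  -(x 0 * y 0) + x 1 * y 1 + x 2 * y 2 + x 3 * y 3 + x 4 * y 4

/-- The light cone `L⁴ ⊂ ℝ^{4,1}`. -/
def LightCone (x : Fin 5 → ℝ) : Prop :=
  x ≠ 0 ∧ mink x x = 0

/-- The map `Γ^q_{p,p'}` of the paper. -/
def Gamma (p p' : Fin 5 → ℝ) (q : ℝ) (X : Fin 5 → ℝ) : Fin 5 → ℝ :=
  X + (1 / mink p p') •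
    (((q - 1) * mink X p') • p + ((1 / q - 1) * mink X p) • p')

/-- Two vectors are proportional if one is a scalar multiple of the other. -/
def Proportional (x y : Fin 5 → ℝ) : Prop :=
  (∃ t : ℝ, y = t • x) ∨ (∃ t : ℝ, x = t • y)

/-- Membership in the rectangular grid `M`. -/
def InGrid (m₁ m₂ n₁ n₂ : ℤ) (i : ℤ × ℤ) : Prop :=
  m₁ ≤ i.1 ∧ i.1 ≤ m₂ ∧ n₁ ≤ i.2 ∧ i.2 ≤ n₂

/-- `(i,j)` is an edge of the grid (in either orientation). -/
def IsEdge (m₁ m₂ n₁ n₂ : ℤ) (i j : ℤ × ℤ) : Prop :=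
  InGrid m₁ m₂ n₁ n₂ i ∧ InGrid m₁ m₂ n₁ n₂ j ∧
    ((j.1 = i.1 + 1 ∧ j.2 = i.2) ∨ (i.1 = j.1 + 1 ∧ i.2 = j.2) ∨
     (j.1 = i.1 ∧ j.2 = i.2 + 1) ∨ (i.1 = j.1 ∧ i.2 = j.2 + 1))

/-- `(i,j,k,l)` is an elementary quadrilateral (face) of the grid. -/
def IsFace (m₁ m₂ n₁ n₂ : ℤ) (i j k l : ℤ × ℤ) : Prop :=
  InGrid m₁ m₂ n₁ n₂ i ∧ InGrid m₁ m₂ n₁ n₂ k ∧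
    j = (i.1 + 1, i.2) ∧ k = (i.1 + 1, i.2 + 1) ∧ l = (i.1, i.2 + 1)

/-- Four vectors are pairwise non-proportional. -/
def FaceRegular (v w x y : Fin 5 → ℝ) : Prop :=
  ¬ Proportional v w ∧ ¬ Proportional v x ∧ ¬ Proportional v y ∧
  ¬ Proportional w x ∧ ¬ Proportional w y ∧ ¬ Proportional x y

/-- A discrete isothermic net (with values in the light cone) with cross ratio
factorizing function `a`. -/
structure IsIsothermic (m₁ m₂ n₁ n₂ : ℤ) (F : ℤ × ℤ → Fin 5 → ℝ)
    (a : ℤ × ℤ → ℤ × ℤ → ℝ) : Prop where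
  lightcone : ∀ i, InGrid m₁ m₂ n₁ n₂ i → LightCone (F i)
  regular : ∀ i j k l, IsFace m₁ m₂ n₁ n₂ i j k l →
    FaceRegular (F i) (F j) (F k) (F l)
  symm : ∀ i j, IsEdge m₁ m₂ n₁ n₂ i j → a i j = a j i
  nonzero : ∀ i j, IsEdge m₁ m₂ n₁ n₂ i j → a i j ≠ 0
  opposite : ∀ i j k l, IsFace m₁ m₂ n₁ n₂ i j k l →
    a i j = a l k ∧ a i l = a j k
  cross : ∀ i j k l, IsFace m₁ m₂ n₁ n₂ i j k l →
    ∃ t : ℝ, t ≠ 0 ∧ F k = t • Gamma (F j) (F l) (a i j / a i l) (F i)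

/-- Evaluation of the polynomial with vector coefficients `P i 0, …, P i N`
at the spectral parameter `lam`. -/
def pcqEval (N : ℕ) (P : ℤ × ℤ → ℕ → Fin 5 → ℝ) (i : ℤ × ℤ) (lam : ℝ) :
    Fin 5 → ℝ :=
  ∑ k ∈ Finset.range (N + 1), lam ^ k • P i k

/-- `P` is a polynomial conserved quantity of degree at most `N` of the net `F`
with cross ratio factorizing function `a`. -/
def IsPCQ (m₁ m₂ n₁ n₂ : ℤ) (F : ℤ × ℤ → Fin 5 → ℝ) (a : ℤ × ℤ → ℤ × ℤ → ℝ)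
    (N : ℕ) (P : ℤ × ℤ → ℕ → Fin 5 → ℝ) : Prop :=
  ∀ i j, IsEdge m₁ m₂ n₁ n₂ i j → ∀ lam : ℝ, lam * a i j ≠ 1 →
    pcqEval N P i lam = Gamma (F i) (F j) (1 - lam * a i j) (pcqEval N P j lam)

/-- A polynomial conserved quantity is normalized (of degree `N`) if its top
coefficient has Minkowski square norm one at every vertex. -/
def Normalized (m₁ m₂ n₁ n₂ : ℤ) (N : ℕ) (P : ℤ × ℤ → ℕ → Fin 5 → ℝ) : Prop :=
  ∀ i, InGrid m₁ m₂ n₁ n₂ i → mink (P i N) (P i N) = 1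

/-- A Darboux transform of `F` with parameter `μ`. -/
def IsDarboux (m₁ m₂ n₁ n₂ : ℤ) (F : ℤ × ℤ → Fin 5 → ℝ) (a : ℤ × ℤ → ℤ × ℤ → ℝ)
    (μ : ℝ) (Fh : ℤ × ℤ → Fin 5 → ℝ) : Prop :=
  (∀ i, InGrid m₁ m₂ n₁ n₂ i → LightCone (Fh i)) ∧
  (∀ i, InGrid m₁ m₂ n₁ n₂ i → ¬ Proportional (F i) (Fh i)) ∧
  (∀ i j, IsEdge m₁ m₂ n₁ n₂ i j → Fh i = Gamma (F i) (F j) (1 - μ * a i j) (Fh j))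

/-- A Calapso transformation of `F` at parameter `μ`: a vertexwise family of
linear isometries of `ℝ^{4,1}` gauging the isothermic connection at `μ` to the
trivial connection. -/
def IsCalapso (m₁ m₂ n₁ n₂ : ℤ) (F : ℤ × ℤ → Fin 5 → ℝ) (a : ℤ × ℤ → ℤ × ℤ → ℝ)
    (μ : ℝ) (T : ℤ × ℤ → (Fin 5 → ℝ) → (Fin 5 → ℝ)) : Prop :=
  (∀ i, InGrid m₁ m₂ n₁ n₂ i → IsLinearMap ℝ (T i)) ∧
  (∀ i, InGrid m₁ m₂ n₁ n₂ i → ∀ x y, mink (T i x) (T i y) = mink x y) ∧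
  (∀ i j, IsEdge m₁ m₂ n₁ n₂ i j → ∀ x,
    T j x = T i (Gamma (F i) (F j) (1 - μ * a i j) x))

theorem mink_add_left (x y z : Fin 5 → ℝ) : mink (x + y) z = mink x z + mink y z := by
  simp only [mink, Pi.add_apply]; ring

theorem mink_smul_left (c : ℝ) (x z : Fin 5 → ℝ) : mink (c • x) z = c * mink x z := by
  simp only [mink, Pi.smul_apply, smul_eq_mul]; ring

theorem mink_comm' (x z : Fin 5 → ℝ) : mink x z = mink z x := by
  simp only [mink]; ring

theorem mink_add_right (x y z : Fin 5 → ℝ) : mink z (x + y) = mink z x + mink z y := by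
  simp only [mink, Pi.add_apply]; ring

theorem mink_smul_right (c : ℝ) (x z : Fin 5 → ℝ) : mink z (c • x) = c * mink z x := by
  simp only [mink, Pi.smul_apply, smul_eq_mul]; ring

theorem mink_nonneg_of_perp (f z : Fin 5 → ℝ) (hf : LightCone f) (h : mink z f = 0) :
    0 ≤ mink z z := by
  obtain ⟨hf0, hff⟩ := hf
  unfold mink at *
  have h0 : f 0 ≠ 0 := by
    intro h0
    apply hf0
    rw [h0] at hff
    have e1 : f 1 = 0 := by
      apply pow_eq_zero_iff (two_ne_zero) |>.1
      nlinarith [sq_nonneg (f 1), sq_nonneg (f 2), sq_nonneg (f 3), sq_nonneg (f 4)]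
    have e2 : f 2 = 0 := by
      apply pow_eq_zero_iff (two_ne_zero) |>.1
      nlinarith [sq_nonneg (f 1), sq_nonneg (f 2), sq_nonneg (f 3), sq_nonneg (f 4)]
    have e3 : f 3 = 0 := by
      apply pow_eq_zero_iff (two_ne_zero) |>.1
      nlinarith [sq_nonneg (f 1), sq_nonneg (f 2), sq_nonneg (f 3), sq_nonneg (f 4)]
    have e4 : f 4 = 0 := by
      apply pow_eq_zero_iff (two_ne_zero) |>.1
      nlinarith [sq_nonneg (f 1), sq_nonneg (f 2), sq_nonneg (f 3), sq_nonneg (f 4)]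
    ext k
    fin_cases k <;> simp [h0, e1, e2, e3, e4]
  have hp : 0 < f 0 ^ 2 := by positivity
  have key : 0 ≤ f 0 ^ 2 * (-(z 0 * z 0) + z 1 * z 1 + z 2 * z 2 + z 3 * z 3 + z 4 * z 4) := by
    have : f 0 ^ 2 * (-(z 0 * z 0) + z 1 * z 1 + z 2 * z 2 + z 3 * z 3 + z 4 * z 4)
      = (z 1 * f 2 - z 2 * f 1)^2 + (z 1 * f 3 - z 3 * f 1)^2 + (z 1 * f 4 - z 4 * f 1)^2
       + (z 2 * f 3 - z 3 * f 2)^2 + (z 2 * f 4 - z 4 * f 2)^2 + (z 3 * f 4 - z 4 * f 3)^2 := by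
      linear_combination (-(z 1 * z 1 + z 2 * z 2 + z 3 * z 3 + z 4 * z 4)) * hff
        + (z 0 * f 0 + (z 1 * f 1 + z 2 * f 2 + z 3 * f 3 + z 4 * f 4)) * h
    rw [this]; positivity
  exact nonneg_of_mul_nonneg_right key hp

theorem Gamma_mem (F G X : Fin 5 → ℝ) (q : ℝ) :
    ∃ x y : ℝ, Gamma F G q X = X + (x • F + y • G) := by
  refine ⟨(1 / mink F G) * ((q - 1) * mink X G), (1 / mink F G) * ((1 / q - 1) * mink X F), ?_⟩
  simp only [Gamma, smul_add, smul_smul]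

theorem edge_rel (F G X Y : Fin 5 → ℝ) (al be a μ₁ μ₂ : ℝ) (ha : a ≠ 0)
    (h1 : μ₁ * a ≠ 1) (h2 : μ₂ * a ≠ 1)
    (hF : mink F F = 0) (hG : mink G G = 0) (hg : mink F G ≠ 0)
    (h : al • Gamma F G (1 - μ₁ * a) X + be • Gamma F G (1 - μ₂ * a) Y = al • X + be • Y) :
    al * μ₁ * mink X G + be * μ₂ * mink Y G = 0 ∧
    al * μ₁ * mink X F * (1 - μ₂ * a) + be * μ₂ * mink Y F * (1 - μ₁ * a) = 0 := by
  have q1 : 1 - μ₁ * a ≠ 0 := fun h => h1 (by linarith)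
  have q2 : 1 - μ₂ * a ≠ 0 := fun h => h2 (by linarith)
  have e1 := congrArg (fun v => mink v G) h
  have e2 := congrArg (fun v => mink v F) h
  simp only [Gamma, mink_add_left, mink_smul_left, hF, hG, mink_comm' G F] at e1 e2
  have hig : 1 / mink F G * mink F G = 1 := one_div_mul_cancel hg
  have hr1 : 1 / (1 - μ₁ * a) * (1 - μ₁ * a) = 1 := one_div_mul_cancel q1
  have hr2 : 1 / (1 - μ₂ * a) * (1 - μ₂ * a) = 1 := one_div_mul_cancel q2
  generalize 1 / mink F G = ig at *
  generalize 1 / (1 - μ₁ * a) = t1 at *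
  generalize 1 / (1 - μ₂ * a) = t2 at *
  have T : al * (t1 - 1) * mink X F + be * (t2 - 1) * mink Y F = 0 := by
    linear_combination e2 - (al * (t1 - 1) * mink X F + be * (t2 - 1) * mink Y F) * hig
  constructor
  · apply mul_left_cancel₀ ha
    linear_combination -e1 - a * (al * μ₁ * mink X G + be * μ₂ * mink Y G) * hig
  · apply mul_left_cancel₀ ha
    linear_combination (1 - μ₁ * a) * (1 - μ₂ * a) * T
      - al * mink X F * (1 - μ₂ * a) * hr1 - be * mink Y F * (1 - μ₁ * a) * hr2

theorem edge_pcq (F G X Y : Fin 5 → ℝ) (al be a μ₁ μ₂ c l : ℝ) (ha : a ≠ 0)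
    (hm1 : μ₁ ≠ 0) (hm2 : μ₂ ≠ 0)
    (h1 : μ₁ * a ≠ 1) (h2 : μ₂ * a ≠ 1) (hl : l * a ≠ 1)
    (hF : mink F F = 0) (hG : mink G G = 0) (hg : mink F G ≠ 0)
    (h : al • Gamma F G (1 - μ₁ * a) X + be • Gamma F G (1 - μ₂ * a) Y = al • X + be • Y) :
    (c * (1 - l / μ₂) * al) • Gamma F G (1 - μ₁ * a) X +
      (c * (1 - l / μ₁) * be) • Gamma F G (1 - μ₂ * a) Y =
    Gamma F G (1 - l * a) ((c * (1 - l / μ₂) * al) • X + (c * (1 - l / μ₁) * be) • Y) := by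
  obtain ⟨r1, r2⟩ := edge_rel F G X Y al be a μ₁ μ₂ ha h1 h2 hF hG hg h
  have q1 : 1 - μ₁ * a ≠ 0 := fun h => h1 (by linarith)
  have q2 : 1 - μ₂ * a ≠ 0 := fun h => h2 (by linarith)
  have q3 : 1 - l * a ≠ 0 := fun h => hl (by linarith)
  have A : (c * (1 - l / μ₂) * al) * (1 - μ₁ * a - 1) * mink X G
      + (c * (1 - l / μ₁) * be) * (1 - μ₂ * a - 1) * mink Y G
      = (1 - l * a - 1) * ((c * (1 - l / μ₂) * al) * mink X G
      + (c * (1 - l / μ₁) * be) * mink Y G) := by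
    have hv : be * mink Y G = -(al * μ₁ * mink X G) / μ₂ := by
      field_simp; linear_combination r1
    have e : ∀ s : ℝ, s * be * mink Y G = s * (-(al * μ₁ * mink X G) / μ₂) := by
      intro s; rw [← hv]; ring
    have e' : ∀ s t : ℝ, s * be * t * mink Y G = s * t * (-(al * μ₁ * mink X G) / μ₂) := by
      intro s t; rw [← hv]; ring
    rw [e, e']
    field_simp
    ring
  have B : (c * (1 - l / μ₂) * al) * (1 / (1 - μ₁ * a) - 1) * mink X F
      + (c * (1 - l / μ₁) * be) * (1 / (1 - μ₂ * a) - 1) * mink Y F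
      = (1 / (1 - l * a) - 1) * ((c * (1 - l / μ₂) * al) * mink X F
      + (c * (1 - l / μ₁) * be) * mink Y F) := by
    have hv : be * mink Y F = -(al * μ₁ * mink X F * (1 - μ₂ * a)) / (μ₂ * (1 - μ₁ * a)) := by
      field_simp; linear_combination r2
    have e : ∀ s : ℝ, s * be * mink Y F
        = s * (-(al * μ₁ * mink X F * (1 - μ₂ * a)) / (μ₂ * (1 - μ₁ * a))) := by
      intro s; rw [← hv]; ring
    have e' : ∀ s t : ℝ, s * be * t * mink Y F
        = s * t * (-(al * μ₁ * mink X F * (1 - μ₂ * a)) / (μ₂ * (1 - μ₁ * a))) := by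
      intro s t; rw [← hv]; ring
    rw [e, e']
    field_simp
    ring
  ext k
  simp only [Gamma, mink_add_left, mink_smul_left, Pi.add_apply, Pi.smul_apply, smul_eq_mul]
  linear_combination (1 / mink F G) * F k * A + (1 / mink F G) * G k * B

/-- two Darboux transforms with different parameters that are
"antipodal" in a space form (i.e. a fixed non-null vector `Q` lies in their
pointwise span) give rise to a normalized linear conserved quantity. -/
theorem statement17 (m₁ m₂ n₁ n₂ : ℤ) (F Fh1 Fh2 : ℤ × ℤ → Fin 5 → ℝ)
    (a : ℤ × ℤ → ℤ × ℤ → ℝ)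
    (hiso : IsIsothermic m₁ m₂ n₁ n₂ F a)
    (μ₁ μ₂ : ℝ) (hμ1 : μ₁ ≠ 0) (hμ2 : μ₂ ≠ 0) (hμ12 : μ₁ ≠ μ₂)
    (hadm1 : ∀ i j, IsEdge m₁ m₂ n₁ n₂ i j → μ₁ * a i j ≠ 1)
    (hadm2 : ∀ i j, IsEdge m₁ m₂ n₁ n₂ i j → μ₂ * a i j ≠ 1)
    (hD1 : IsDarboux m₁ m₂ n₁ n₂ F a μ₁ Fh1)
    (hD2 : IsDarboux m₁ m₂ n₁ n₂ F a μ₂ Fh2)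
    (hindepV : ∀ i, InGrid m₁ m₂ n₁ n₂ i → ∀ c₁ c₂ : ℝ,
      c₁ • Fh1 i + c₂ • Fh2 i ∈
        Submodule.span ℝ ({F i} : Set (Fin 5 → ℝ)) → c₁ = 0 ∧ c₂ = 0)
    (hindepE : ∀ i j, IsEdge m₁ m₂ n₁ n₂ i j → ∀ c₁ c₂ : ℝ,
      c₁ • Fh1 i + c₂ • Fh2 i ∈
        Submodule.span ℝ ({F i, F j} : Set (Fin 5 → ℝ)) → c₁ = 0 ∧ c₂ = 0)
    (Q : Fin 5 → ℝ) (hQ0 : Q ≠ 0) (hQn : mink Q Q ≠ 0)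
    (hQspan : ∀ i, InGrid m₁ m₂ n₁ n₂ i →
      Q ∈ Submodule.span ℝ ({Fh1 i, Fh2 i} : Set (Fin 5 → ℝ))) :
    ∃ (Z : ℤ × ℤ → Fin 5 → ℝ) (Q' : Fin 5 → ℝ),
      (∀ i, InGrid m₁ m₂ n₁ n₂ i → mink (Z i) (Z i) = 1) ∧
      IsPCQ m₁ m₂ n₁ n₂ F a 1
        (fun i k => if k = 0 then Q' else if k = 1 then Z i else 0) := by
  by_cases hex : ∃ i j, IsEdge m₁ m₂ n₁ n₂ i j ∧ mink (F i) (F j) ≠ 0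
  swap
  · push Not at hex
    refine ⟨fun _ => ![0, 1, 0, 0, 0], 0, ?_, ?_⟩
    · intro i _
      simp [mink]
    · intro i j hij lam _
      simp [pcqEval, Gamma, hex i j hij, Finset.sum_range_succ]
  have hc : ∀ i, ∃ al be : ℝ, InGrid m₁ m₂ n₁ n₂ i → al • Fh1 i + be • Fh2 i = Q := by
    intro i
    by_cases hi : InGrid m₁ m₂ n₁ n₂ i
    · obtain ⟨al, be, h⟩ := Submodule.mem_span_pair.1 (hQspan i hi)
      exact ⟨al, be, fun _ => h⟩
    · exact ⟨0, 0, fun h => absurd h hi⟩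
  choose al be hab using hc
  have hconst : ∀ i j, IsEdge m₁ m₂ n₁ n₂ i j → al i = al j ∧ be i = be j := by
    intro i j hij
    have hi := hab i hij.1
    have hj := hab j hij.2.1
    obtain ⟨x1, y1, e1⟩ := Gamma_mem (F i) (F j) (Fh1 j) (1 - μ₁ * a i j)
    obtain ⟨x2, y2, e2⟩ := Gamma_mem (F i) (F j) (Fh2 j) (1 - μ₂ * a i j)
    rw [← hD1.2.2 i j hij] at e1
    rw [← hD2.2.2 i j hij] at e2
    have := hindepE i j hij (al i - al j) (be i - be j) (by
      rw [Submodule.mem_span_pair]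
      refine ⟨-(al j * x1 + be j * x2), -(al j * y1 + be j * y2), ?_⟩
      rw [← hj] at hi
      ext k
      have h1 := congrFun e1 k
      have h2 := congrFun e2 k
      have h3 := congrFun hi k
      simp only [Pi.add_apply, Pi.smul_apply, smul_eq_mul] at *
      linear_combination -h3 + al j * h1 + be j * h2)
    exact ⟨by linarith [this.1], by linarith [this.2]⟩
  have hrel : ∀ i j, IsEdge m₁ m₂ n₁ n₂ i j →
      al j • Gamma (F i) (F j) (1 - μ₁ * a i j) (Fh1 j) +
      be j • Gamma (F i) (F j) (1 - μ₂ * a i j) (Fh2 j) = al j • Fh1 j + be j • Fh2 j := by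
    intro i j hij
    rw [← hD1.2.2 i j hij, ← hD2.2.2 i j hij, hab j hij.2.1, ← (hconst i j hij).1,
      ← (hconst i j hij).2, hab i hij.1]
  have hnorm : ∀ (c : ℝ) i, InGrid m₁ m₂ n₁ n₂ i →
      mink ((-c * al i / μ₂) • Fh1 i + (-c * be i / μ₁) • Fh2 i)
        ((-c * al i / μ₂) • Fh1 i + (-c * be i / μ₁) • Fh2 i) = c ^ 2 * (mink Q Q / (μ₁ * μ₂)) := by
    intro c i hi
    rw [← hab i hi]
    simp only [mink_add_left, mink_add_right, mink_smul_left, mink_smul_right,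
      (hD1.1 i hi).2, (hD2.1 i hi).2, mink_comm' (Fh2 i) (Fh1 i)]
    field_simp
    ring
  have hpos : 0 < mink Q Q / (μ₁ * μ₂) := by
    obtain ⟨i, j, hij, hg⟩ := hex
    have hne : mink Q Q / (μ₁ * μ₂) ≠ 0 := div_ne_zero hQn (mul_ne_zero hμ1 hμ2)
    have r := (edge_rel (F i) (F j) (Fh1 j) (Fh2 j) (al j) (be j) (a i j) μ₁ μ₂
      (hiso.nonzero i j hij) (hadm1 i j hij) (hadm2 i j hij) (hiso.lightcone i hij.1).2
      (hiso.lightcone j hij.2.1).2 hg (hrel i j hij)).1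
    have h0 := mink_nonneg_of_perp (F j) (hf := hiso.lightcone j hij.2.1)
      (z := (-1 * al j / μ₂) • Fh1 j + (-1 * be j / μ₁) • Fh2 j) (h := by
        simp only [mink_add_left, mink_smul_left]
        field_simp
        linear_combination -r)
    rw [hnorm 1 j hij.2.1] at h0
    exact lt_of_le_of_ne (by linarith) hne.symm
  obtain ⟨c, hcc⟩ : ∃ c : ℝ, c ^ 2 * (mink Q Q / (μ₁ * μ₂)) = 1 := by
    refine ⟨Real.sqrt (mink Q Q / (μ₁ * μ₂))⁻¹, ?_⟩
    rw [Real.sq_sqrt (inv_nonneg.2 hpos.le)]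
    exact inv_mul_cancel₀ hpos.ne'
  refine ⟨fun i => (-c * al i / μ₂) • Fh1 i + (-c * be i / μ₁) • Fh2 i, c • Q, ?_, ?_⟩
  · intro i hi
    rw [hnorm c i hi, hcc]
  · intro i j hij lam hlam
    have hev : ∀ i, InGrid m₁ m₂ n₁ n₂ i → pcqEval 1 (fun i k => if k = 0 then c • Q else
        if k = 1 then (-c * al i / μ₂) • Fh1 i + (-c * be i / μ₁) • Fh2 i else 0) i lam =
        (c * (1 - lam / μ₂) * al i) • Fh1 i + (c * (1 - lam / μ₁) * be i) • Fh2 i := by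
      intro i hi
      rw [← hab i hi]
      ext k
      simp [pcqEval, Finset.sum_range_succ]
      ring
    rw [hev i hij.1, hev j hij.2.1, (hconst i j hij).1, (hconst i j hij).2]
    have E1 := hD1.2.2 i j hij
    have E2 := hD2.2.2 i j hij
    by_cases hg : mink (F i) (F j) = 0
    · have hid : ∀ q X, Gamma (F i) (F j) q X = X := by
        intro q X; simp [Gamma, hg]
      rw [hid] at E1 E2 ⊢
      rw [E1, E2]
    · rw [E1, E2]
      exact edge_pcq (F i) (F j) (Fh1 j) (Fh2 j) (al j) (be j) (a i j) μ₁ μ₂ c lam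
        (hiso.nonzero i j hij) hμ1 hμ2 (hadm1 i j hij) (hadm2 i j hij) hlam
        (hiso.lightcone i hij.1).2 (hiso.lightcone j hij.2.1).2 hg (hrel i j hij)
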